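/- In the clipping ANN setting, assume Lip(f) < min_{i ∈ {1,…,h}} v_i w_i, let θ ∈ ℝ^{h+1} satisfy (∇L)(θ) = 0, and let i, j ∈ {1, …, h} satisfy I_i^θ ∩ I_j^θ ≠ ∅. Then I_i^θ ⊆ I_j^θ or I_j^θ ⊆ I_i^θ. -/

import Mathlib

open MeasureTheory Filter

noncomputable section

/-- The clipping function `x ↦ min{max{x,0},1}`. -/
def clipFn (x : ℝ) : ℝ := min (max x 0) 1

/-- `ψ_i(θ) = -θ_i / w_i`. -/
def psiC {h : ℕ} (w : Fin h → ℝ) (θ : Fin (h + 1) → ℝ) (i : Fin h) : ℝ :=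
  -θ i.castSucc / w i

/-- The activity interval `I_i^θ = (ψ_i(θ), ψ_i(θ) + 1/w_i) ∩ (a, b)`. -/
def actI {h : ℕ} (a b : ℝ) (w : Fin h → ℝ) (θ : Fin (h + 1) → ℝ) (i : Fin h) : Set ℝ :=
  Set.Ioo (psiC w θ i) (psiC w θ i + (w i)⁻¹) ∩ Set.Ioo a b

/-- The realization function `N^θ(x) = θ_{h+1} + ∑_i v_i c(w_i x + θ_i)`. -/
def realC {h : ℕ} (v w : Fin h → ℝ) (θ : Fin (h + 1) → ℝ) (x : ℝ) : ℝ :=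
  θ (Fin.last h) + ∑ i : Fin h, v i * clipFn (w i * x + θ i.castSucc)

/-- The risk `L(θ) = ∫_a^b (N^θ(x) - f(x))² p(x) dx`. -/
def riskC {h : ℕ} (a b : ℝ) (v w : Fin h → ℝ) (f p : ℝ → ℝ) (θ : Fin (h + 1) → ℝ) : ℝ :=
  ∫ x in Set.Ioo a b, (realC v w θ x - f x) ^ 2 * p x

/-- The gradient `∇L(θ)` as a vector of partial derivatives. -/
def gradC {h : ℕ} (a b : ℝ) (v w : Fin h → ℝ) (f p : ℝ → ℝ) (θ : Fin (h + 1) → ℝ) :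
    Fin (h + 1) → ℝ :=
  fun k => fderiv ℝ (riskC a b v w f p) θ (Pi.single k 1)

/-- `x` is a descending critical point of `g` : `∇g(x) = 0` and the Hessian quadratic form
admits a negative value. -/
def IsDescCrit {n : ℕ} (g : (Fin n → ℝ) → ℝ) (x : Fin n → ℝ) : Prop :=
  fderiv ℝ g x = 0 ∧ ∃ u : Fin n → ℝ, iteratedFDeriv ℝ 2 g x ![u, u] < 0

/-- The Euclidean norm on `Fin n → ℝ`. -/
def euclNorm {n : ℕ} (x : Fin n → ℝ) : ℝ := Real.sqrt (∑ i, (x i) ^ 2)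

/-- Piecewise polynomial functions. -/
def PiecewisePoly (F : ℝ → ℝ) : Prop :=
  ∃ (K : ℕ) (τ : ℕ → EReal), 0 < K ∧ τ 0 = ⊥ ∧ τ K = ⊤ ∧
    (∀ k, k < K → τ k < τ (k + 1)) ∧
    ∀ k, k < K → ∃ q : Polynomial ℝ, ∀ x : ℝ,
      τ k < (x : EReal) → (x : EReal) < τ (k + 1) → F x = q.eval x

lemma clipFn_monotone : Monotone clipFn := fun x y hxy => by
  unfold clipFn
  gcongr

lemma continuous_clipFn : Continuous clipFn := by
  unfold clipFn
  fun_prop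

lemma abs_clipFn_sub_le (x y : ℝ) : |clipFn x - clipFn y| ≤ |x - y| := by
  unfold clipFn
  exact (abs_inf_sub_inf_le_abs _ _ _).trans (abs_sup_sub_sup_le_abs _ _ _)

lemma clipFn_of_mem_Icc {x : ℝ} (hx : x ∈ Set.Icc (0 : ℝ) 1) : clipFn x = x := by
  unfold clipFn
  rw [max_eq_left hx.1, min_eq_left hx.2]

lemma hasDerivAt_clipFn {x : ℝ} (h0 : x ≠ 0) (h1 : x ≠ 1) :
    HasDerivAt clipFn ((Set.Ioo (0 : ℝ) 1).indicator 1 x) x := by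
  rcases lt_or_gt_of_ne h0 with h0 | h0
  · rw [Set.indicator_of_notMem (fun hx => h0.not_gt hx.1)]
    refine (hasDerivAt_const x (0 : ℝ)).congr_of_eventuallyEq ?_
    filter_upwards [Iio_mem_nhds h0] with y hy
    simp [clipFn, max_eq_right (show y < 0 from hy).le]
  rcases lt_or_gt_of_ne h1 with h1 | h1
  · rw [Set.indicator_of_mem (show x ∈ Set.Ioo (0 : ℝ) 1 from ⟨h0, h1⟩)]
    refine (hasDerivAt_id x).congr_of_eventuallyEq ?_
    filter_upwards [Icc_mem_nhds h0 h1] with y hy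
    exact clipFn_of_mem_Icc hy
  · rw [Set.indicator_of_notMem (fun hx => h1.not_gt hx.2)]
    refine (hasDerivAt_const x (1 : ℝ)).congr_of_eventuallyEq ?_
    filter_upwards [Ioi_mem_nhds h1] with y hy
    exact min_eq_right (le_max_of_le_left (le_of_lt hy))

lemma continuous_realC {h : ℕ} (v w : Fin h → ℝ) (θ : Fin (h + 1) → ℝ) :
    Continuous (realC v w θ) := by
  have := continuous_clipFn
  unfold realC
  fun_prop

/-- The realization function is Lipschitz in the parameter, uniformly in the input. -/
lemma abs_realC_sub_le {h : ℕ} {v : Fin h → ℝ} (w : Fin h → ℝ) (hv : ∀ i, 0 < v i)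
    (θ η : Fin (h + 1) → ℝ) (x : ℝ) :
    |realC v w θ x - realC v w η x| ≤ (1 + ∑ i, v i) * ‖θ - η‖ := by
  have hcoord (k) : |θ k - η k| ≤ ‖θ - η‖ := norm_le_pi_norm (θ - η) k
  have hsplit : realC v w θ x - realC v w η x = (θ (Fin.last h) - η (Fin.last h)) +
      ∑ i, v i * (clipFn (w i * x + θ i.castSucc) - clipFn (w i * x + η i.castSucc)) := by
    simp only [realC, mul_sub, Finset.sum_sub_distrib]
    ring
  rw [hsplit, add_mul, one_mul, Finset.sum_mul]
  refine (abs_add_le _ _).trans (add_le_add (hcoord _) ((Finset.abs_sum_le_sum_abs _ _).trans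
    (Finset.sum_le_sum fun i _ => ?_)))
  rw [abs_mul, abs_of_pos (hv i)]
  refine mul_le_mul_of_nonneg_left ((abs_clipFn_sub_le _ _).trans ?_) (hv i).le
  simpa using hcoord i.castSucc

/-- The parameter gradient of the realization function at the input `x`. -/
def gradRealC {h : ℕ} (v w : Fin h → ℝ) (θ : Fin (h + 1) → ℝ) (x : ℝ) :
    (Fin (h + 1) → ℝ) →L[ℝ] ℝ :=
  ContinuousLinearMap.proj (R := ℝ) (φ := fun _ : Fin (h + 1) => ℝ) (Fin.last h) +
    ∑ i : Fin h, (v i * (Set.Ioo (0 : ℝ) 1).indicator 1 (w i * x + θ i.castSucc)) •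
      ContinuousLinearMap.proj (R := ℝ) (φ := fun _ : Fin (h + 1) => ℝ) i.castSucc

lemma gradRealC_single {h : ℕ} (v w : Fin h → ℝ) (θ : Fin (h + 1) → ℝ) (x : ℝ) (i : Fin h) :
    gradRealC v w θ x (Pi.single i.castSucc 1) =
      v i * (Set.Ioo (0 : ℝ) 1).indicator 1 (w i * x + θ i.castSucc) := by
  simp [gradRealC, Pi.single_apply]

lemma stronglyMeasurable_gradRealC {h : ℕ} (v w : Fin h → ℝ) (θ : Fin (h + 1) → ℝ) :
    StronglyMeasurable (gradRealC v w θ) := by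
  unfold gradRealC
  refine stronglyMeasurable_const.add (Finset.stronglyMeasurable_fun_sum _ fun i _ => ?_)
  refine StronglyMeasurable.smul_const (Measurable.stronglyMeasurable ?_) _
  have : Measurable ((Set.Ioo (0 : ℝ) 1).indicator (1 : ℝ → ℝ)) :=
    measurable_one.indicator measurableSet_Ioo
  exact (this.comp (by fun_prop : Measurable fun x => w i * x + θ i.castSucc)).const_mul _

lemma hasFDerivAt_realC {h : ℕ} (v w : Fin h → ℝ) (θ : Fin (h + 1) → ℝ) {x : ℝ}
    (hx : ∀ i, w i * x + θ i.castSucc ≠ 0 ∧ w i * x + θ i.castSucc ≠ 1) :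
    HasFDerivAt (fun η => realC v w η x) (gradRealC v w θ x) θ := by
  unfold realC gradRealC
  refine (hasFDerivAt_apply _ _).add (HasFDerivAt.fun_sum fun i _ => ?_)
  have := ((hasDerivAt_clipFn (hx i).1 (hx i).2).comp_hasFDerivAt θ
    ((hasFDerivAt_apply (𝕜 := ℝ) i.castSucc θ).const_add (w i * x))).const_mul (v i)
  rw [mul_smul]
  exact this

lemma ae_ne_breakpoints {h : ℕ} {w : Fin h → ℝ} (hw : ∀ i, 0 < w i) (θ : Fin (h + 1) → ℝ)
    (μ : Measure ℝ) [NullSingletonClass μ] :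
    ∀ᵐ x ∂μ, ∀ i, w i * x + θ i.castSucc ≠ 0 ∧ w i * x + θ i.castSucc ≠ 1 := by
  rw [ae_all_iff]
  intro i
  have hne (c : ℝ) : ∀ᵐ x ∂μ, w i * x + θ i.castSucc ≠ c := by
    filter_upwards [compl_mem_ae_iff.2 (measure_singleton ((c - θ i.castSucc) / w i))] with x hx hc
    refine hx ?_
    rw [Set.mem_singleton_iff, eq_div_iff (hw i).ne']
    linarith
  filter_upwards [hne 0, hne 1] with x h0 h1 using ⟨h0, h1⟩

lemma hasFDerivAt_riskC {h : ℕ} (a b : ℝ) {v w : Fin h → ℝ} (hv : ∀ i, 0 < v i)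
    (hw : ∀ i, 0 < w i) {f p : ℝ → ℝ} (hf : Continuous f) (hp : Continuous p)
    (θ : Fin (h + 1) → ℝ) :
    Integrable (fun x => (2 * (realC v w θ x - f x) * p x) • gradRealC v w θ x)
      (volume.restrict (Set.Ioo a b)) ∧
    HasFDerivAt (riskC a b v w f p)
      (∫ x in Set.Ioo a b, (2 * (realC v w θ x - f x) * p x) • gradRealC v w θ x) θ := by
  have hN := continuous_realC v w
  set M := 1 + ∑ i, v i with hM
  have hM0 : 0 ≤ M := add_nonneg zero_le_one (Finset.sum_nonneg fun i _ => (hv i).le)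
  have hint {F : ℝ → ℝ} (hF : Continuous F) : Integrable F (volume.restrict (Set.Ioo a b)) :=
    (hF.integrableOn_Icc (a := a) (b := b)).mono_set Set.Ioo_subset_Icc_self
  have hNθ := hN θ
  refine hasFDerivAt_integral_of_dominated_loc_of_lip
    (F := fun η x => (realC v w η x - f x) ^ 2 * p x)
    (bound := fun x => 2 * M * (|realC v w θ x - f x| + M) * |p x|)
    (Metric.ball_mem_nhds θ one_pos) (Eventually.of_forall fun η => ?_) (hint (by fun_prop)) ?_
    (ae_of_all _ fun x => ?_) (hint (by fun_prop)) ?_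
  · have := hN η
    exact (by fun_prop : Continuous _).aestronglyMeasurable
  · exact ((by fun_prop : Continuous fun x => 2 * (realC v w θ x - f x) * p x).stronglyMeasurable.smul
      (stronglyMeasurable_gradRealC v w θ)).aestronglyMeasurable
  · refine LipschitzOnWith.of_dist_le_mul fun η hη ζ hζ => ?_
    have hnear {η} (hη : η ∈ Metric.ball θ 1) :
        |realC v w η x - f x| ≤ |realC v w θ x - f x| + M := by
      have h1 := abs_realC_sub_le w hv η θ x
      have h2 : M * ‖η - θ‖ ≤ M * 1 :=
        mul_le_mul_of_nonneg_left (mem_ball_iff_norm.1 hη).le hM0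
      have h3 := abs_add_le (realC v w η x - realC v w θ x) (realC v w θ x - f x)
      rw [sub_add_sub_cancel] at h3
      linarith
    rw [Real.coe_nnabs, abs_of_nonneg (by positivity), Real.dist_eq, dist_eq_norm]
    have hfac : (realC v w η x - f x) ^ 2 * p x - (realC v w ζ x - f x) ^ 2 * p x =
        ((realC v w η x - f x) + (realC v w ζ x - f x)) * (realC v w η x - realC v w ζ x) *
          p x := by ring
    rw [hfac, abs_mul, abs_mul]
    have hsum : |(realC v w η x - f x) + (realC v w ζ x - f x)| ≤
        2 * (|realC v w θ x - f x| + M) :=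
      (abs_add_le _ _).trans (by linarith [hnear hη, hnear hζ])
    calc _ ≤ 2 * (|realC v w θ x - f x| + M) * (M * ‖η - ζ‖) * |p x| := by
          gcongr
          exact abs_realC_sub_le w hv η ζ x
      _ = _ := by ring
  · filter_upwards [ae_ne_breakpoints hw θ _] with x hx
    have := (((hasFDerivAt_realC v w θ hx).sub_const (f x)).pow 2).mul_const (p x)
    refine this.congr_fderiv ?_
    ext η
    simp
    ring

lemma mem_Ioo_zero_one_iff_psiC {h : ℕ} {w : Fin h → ℝ} (hw : ∀ i, 0 < w i)
    (θ : Fin (h + 1) → ℝ) (i : Fin h) (x : ℝ) :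
    w i * x + θ i.castSucc ∈ Set.Ioo (0 : ℝ) 1 ↔
      x ∈ Set.Ioo (psiC w θ i) (psiC w θ i + (w i)⁻¹) := by
  have hψ : psiC w θ i + (w i)⁻¹ = (1 - θ i.castSucc) / w i := by
    unfold psiC
    ring
  rw [Set.mem_Ioo, Set.mem_Ioo, hψ, psiC, div_lt_iff₀ (hw i), lt_div_iff₀ (hw i)]
  constructor <;> rintro ⟨h0, h1⟩ <;> constructor <;> linarith

/-- At a critical point the weighted residual has mean zero over each activity interval. -/
lemma setIntegral_actI_eq_zero {h : ℕ} {a b : ℝ} {v w : Fin h → ℝ} (hv : ∀ i, 0 < v i)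
    (hw : ∀ i, 0 < w i) {f p : ℝ → ℝ} (hf : Continuous f) (hp : Continuous p)
    {θ : Fin (h + 1) → ℝ} (hcrit : fderiv ℝ (riskC a b v w f p) θ = 0) (i : Fin h) :
    ∫ x in actI a b w θ i, (realC v w θ x - f x) * p x = 0 := by
  obtain ⟨hint, hderiv⟩ := hasFDerivAt_riskC a b hv hw hf hp θ
  have happly := congrArg (fun T => T (Pi.single i.castSucc 1)) (hderiv.fderiv.symm.trans hcrit)
  simp only [zero_apply] at happly
  rw [ContinuousLinearMap.integral_apply hint] at happly
  have hpt : ∀ x, ((2 * (realC v w θ x - f x) * p x) • gradRealC v w θ x)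
      (Pi.single i.castSucc 1) = 2 * v i *
        (Set.Ioo (psiC w θ i) (psiC w θ i + (w i)⁻¹)).indicator
          (fun x => (realC v w θ x - f x) * p x) x := by
    intro x
    rw [smul_apply, gradRealC_single, smul_eq_mul]
    by_cases hx : x ∈ Set.Ioo (psiC w θ i) (psiC w θ i + (w i)⁻¹)
    · rw [Set.indicator_of_mem hx,
        Set.indicator_of_mem ((mem_Ioo_zero_one_iff_psiC hw θ i x).2 hx), Pi.one_apply]
      ring
    · rw [Set.indicator_of_notMem hx,
        Set.indicator_of_notMem (fun hx' => hx ((mem_Ioo_zero_one_iff_psiC hw θ i x).1 hx'))]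
      ring
  simp only [hpt] at happly
  rw [integral_const_mul, setIntegral_indicator measurableSet_Ioo, Set.inter_comm] at happly
  exact (mul_eq_zero.1 happly).resolve_left (mul_pos two_pos (hv i)).ne'

lemma actI_eq_Ioo {h : ℕ} (a b : ℝ) (w : Fin h → ℝ) (θ : Fin (h + 1) → ℝ) (i : Fin h) :
    actI a b w θ i = Set.Ioo (max (psiC w θ i) a) (min (psiC w θ i + (w i)⁻¹) b) :=
  Set.Ioo_inter_Ioo

/-- The realization function grows at rate at least `v i * w i` where neuron `i` is active. -/
lemma mul_sub_le_realC_sub {h : ℕ} {v w : Fin h → ℝ} (hv : ∀ i, 0 < v i) (hw : ∀ i, 0 < w i)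
    (θ : Fin (h + 1) → ℝ) (i : Fin h) {x y : ℝ} (hxy : x ≤ y)
    (hx : psiC w θ i ≤ x) (hy : y ≤ psiC w θ i + (w i)⁻¹) :
    v i * w i * (y - x) ≤ realC v w θ y - realC v w θ x := by
  have hx' : 0 ≤ w i * x + θ i.castSucc := by
    rw [psiC, div_le_iff₀ (hw i)] at hx
    linarith
  have hy' : w i * y + θ i.castSucc ≤ 1 := by
    have hψ : psiC w θ i + (w i)⁻¹ = (1 - θ i.castSucc) / w i := by
      unfold psiC
      ring
    rw [hψ, le_div_iff₀ (hw i)] at hy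
    linarith
  have hxy' : w i * x ≤ w i * y := mul_le_mul_of_nonneg_left hxy (hw i).le
  have hsum : realC v w θ y - realC v w θ x =
      ∑ k, v k * (clipFn (w k * y + θ k.castSucc) - clipFn (w k * x + θ k.castSucc)) := by
    simp only [realC, mul_sub, Finset.sum_sub_distrib]
    ring
  have hterm : v i * w i * (y - x) =
      v i * (clipFn (w i * y + θ i.castSucc) - clipFn (w i * x + θ i.castSucc)) := by
    rw [clipFn_of_mem_Icc ⟨hx', by linarith⟩, clipFn_of_mem_Icc ⟨by linarith, hy'⟩]
    ring
  rw [hsum, hterm]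
  refine Finset.single_le_sum (f := fun k =>
    v k * (clipFn (w k * y + θ k.castSucc) - clipFn (w k * x + θ k.castSucc)))
    (fun k _ => mul_nonneg (hv k).le (sub_nonneg.2 (clipFn_monotone ?_))) (Finset.mem_univ i)
  have := mul_le_mul_of_nonneg_left hxy (hw k).le
  linarith

lemma strictMonoOn_realC_sub {h : ℕ} {a b : ℝ} {v w : Fin h → ℝ} (hv : ∀ i, 0 < v i)
    (hw : ∀ i, 0 < w i) {f : ℝ → ℝ} {K : ℝ} (hK : ∀ i, K < v i * w i)
    (hLipf : ∀ x ∈ Set.Icc a b, ∀ y ∈ Set.Icc a b, |f x - f y| ≤ K * |x - y|)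
    (θ : Fin (h + 1) → ℝ) (i : Fin h) :
    StrictMonoOn (fun x => realC v w θ x - f x)
      (Set.Icc (max (psiC w θ i) a) (min (psiC w θ i + (w i)⁻¹) b)) := by
  intro x hx y hy hxy
  obtain ⟨hx1, hx2⟩ := max_le_iff.1 hx.1
  obtain ⟨hy1, hy2⟩ := le_min_iff.1 hy.2
  have hN := mul_sub_le_realC_sub hv hw θ i hxy.le hx1 hy1
  have hL := (le_abs_self _).trans (hLipf y ⟨by linarith, hy2⟩ x ⟨hx2, by linarith⟩)
  rw [abs_of_pos (sub_pos.2 hxy)] at hL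
  have := mul_lt_mul_of_pos_right (hK i) (sub_pos.2 hxy)
  dsimp only
  linarith

/-- Two properly overlapping intervals cannot both carry weighted mean zero of a function that is
strictly increasing on each of them. -/
lemma not_overlapping_of_integral_eq_zero {g p : ℝ → ℝ} (hg : Continuous g) (hp : Continuous p)
    {α β γ δ : ℝ} (hαγ : α < γ) (hγβ : γ < β) (hβδ : β < δ)
    (hpos : ∀ x ∈ Set.Ioo α δ, 0 < p x) (hleft : StrictMonoOn g (Set.Icc α β))
    (hright : StrictMonoOn g (Set.Icc γ δ)) (hI : ∫ x in α..β, g x * p x = 0)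
    (hJ : ∫ x in γ..δ, g x * p x = 0) : False := by
  have hint (s t : ℝ) : IntervalIntegrable (fun x => g x * p x) volume s t :=
    (hg.mul hp).intervalIntegrable s t
  have hposint {s t : ℝ} (hst : s < t) (hs : α ≤ s) (ht : t ≤ δ)
      (hgp : ∀ x ∈ Set.Ioo s t, 0 < g x) : 0 < ∫ x in s..t, g x * p x :=
    intervalIntegral.intervalIntegral_pos_of_pos_on (hint s t)
      (fun x hx => mul_pos (hgp x hx) (hpos x ⟨hs.trans_lt hx.1, hx.2.trans_le ht⟩)) hst
  have hnegint {s t : ℝ} (hst : s < t) (hs : α ≤ s) (ht : t ≤ δ)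
      (hgn : ∀ x ∈ Set.Ioo s t, g x < 0) : ∫ x in s..t, g x * p x < 0 := by
    have := intervalIntegral.intervalIntegral_pos_of_pos_on (hint s t).neg
      (fun x hx => neg_pos.2 (mul_neg_of_neg_of_pos (hgn x hx)
        (hpos x ⟨hs.trans_lt hx.1, hx.2.trans_le ht⟩))) hst
    simpa [intervalIntegral.integral_neg] using this
  have hgγ : g γ < 0 := by
    by_contra! hc
    refine (hposint (hγβ.trans hβδ) hαγ.le le_rfl fun x hx => hc.trans_lt ?_).ne' hJ
    exact hright ⟨le_rfl, (hγβ.trans hβδ).le⟩ ⟨hx.1.le, hx.2.le⟩ hx.1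
  have hgβ : 0 < g β := by
    by_contra! hc
    refine (hnegint (hαγ.trans hγβ) le_rfl hβδ.le fun x hx => lt_of_lt_of_le ?_ hc).ne hI
    exact hleft ⟨hx.1.le, hx.2.le⟩ ⟨(hαγ.trans hγβ).le, le_rfl⟩ hx.2
  have hA := hnegint hαγ le_rfl (hγβ.trans hβδ).le fun x hx =>
    (hleft ⟨hx.1.le, (hx.2.trans hγβ).le⟩ ⟨hαγ.le, hγβ.le⟩ hx.2).trans hgγ
  have hC := hposint hβδ (hαγ.trans hγβ).le le_rfl fun x hx =>
    hgβ.trans (hright ⟨hγβ.le, hβδ.le⟩ ⟨(hγβ.trans hx.1).le, hx.2.le⟩ hx.1)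
  have hAB := intervalIntegral.integral_add_adjacent_intervals (hint α γ) (hint γ β)
  have hBC := intervalIntegral.integral_add_adjacent_intervals (hint γ β) (hint β δ)
  linarith

theorem statement_4
    (a b : ℝ) (hab : a < b) (h : ℕ) (hh : 0 < h)
    (v w : Fin h → ℝ) (hv : ∀ i, 0 < v i) (hw : ∀ i, 0 < w i)
    (f p : ℝ → ℝ) (hf : Continuous f) (hp : Continuous p)
    (hpnn : ∀ x : ℝ, 0 ≤ p x) (hsupp : {x : ℝ | 0 < p x} = Set.Ioo a b)
    -- `Lip(f) < min_i v_i w_i`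
    (K : ℝ) (hK : ∀ i, K < v i * w i)
    (hLipf : ∀ x ∈ Set.Icc a b, ∀ y ∈ Set.Icc a b, |f x - f y| ≤ K * |x - y|)
    (θ : Fin (h + 1) → ℝ) (hcrit : fderiv ℝ (riskC a b v w f p) θ = 0)
    (i j : Fin h) (hne : (actI a b w θ i ∩ actI a b w θ j).Nonempty) :
    actI a b w θ i ⊆ actI a b w θ j ∨ actI a b w θ j ⊆ actI a b w θ i := by
  have hstrict := strictMonoOn_realC_sub hv hw hK hLipf θ
  have hzero := setIntegral_actI_eq_zero hv hw hf hp hcrit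
  obtain ⟨x, hxi, hxj⟩ := hne
  have hg : Continuous fun x => realC v w θ x - f x := (continuous_realC v w θ).sub hf
  have key (k l : Fin h) (hk : x ∈ actI a b w θ k) (hl : x ∈ actI a b w θ l)
      (hkl : max (psiC w θ k) a ≤ max (psiC w θ l) a) :
      actI a b w θ k ⊆ actI a b w θ l ∨ actI a b w θ l ⊆ actI a b w θ k := by
    have hzk := hzero k
    have hzl := hzero l
    rw [actI_eq_Ioo] at hk hl hzk hzl
    rw [actI_eq_Ioo, actI_eq_Ioo]
    rcases le_or_gt (min (psiC w θ l + (w l)⁻¹) b) (min (psiC w θ k + (w k)⁻¹) b) with hle | hlt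
    · exact Or.inr (Set.Ioo_subset_Ioo hkl hle)
    rcases hkl.eq_or_lt with heq | hlt'
    · exact Or.inl (Set.Ioo_subset_Ioo heq.ge hlt.le)
    rw [← integral_Ioc_eq_integral_Ioo,
      ← intervalIntegral.integral_of_le (hk.1.trans hk.2).le] at hzk
    rw [← integral_Ioc_eq_integral_Ioo,
      ← intervalIntegral.integral_of_le (hl.1.trans hl.2).le] at hzl
    refine (not_overlapping_of_integral_eq_zero hg hp hlt' (hl.1.trans hk.2) hlt (fun y hy => ?_)
      (hstrict k) (hstrict l) hzk hzl).elim
    have : y ∈ {x : ℝ | 0 < p x} := by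
      rw [hsupp]
      exact ⟨(le_max_right _ _).trans_lt hy.1, hy.2.trans_le (min_le_right _ _)⟩
    exact this
  rcases le_total (max (psiC w θ i) a) (max (psiC w θ j) a) with hij | hji
  · exact key i j hxi hxj hij
  · exact (key j i hxj hxi hji).symm
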